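/- arXiv:2604.00774 — 5 statements merged into one kernel-verified Lean document; each statement's English description precedes it below -/
import Mathlib

section
/- Let N be a finite nonempty index set of agents, τ ≥ 1 an integer delay bound, and for each i ∈ N let E_i ⊆ N be a neighbor set, n_i ≥ 1 a state dimension, x_i : ℤ → ℝ^{n_i} a state trajectory (only values at times k ≥ −τ are used), and d_i : ℕ → [0,∞) a disturbance-magnitude sequence with D̄ := sup_{k∈ℕ} max_{i∈N} d_i(k) < ∞. Assume there exist p > 1, ε ∈ (0,1), ψ ≥ 0, class-K∞ functions α₁, α₂ with α₁ surjective, functions V_i : ℝ^{n_i} → [0,∞), and gains γ_{ij} ≥ 0 (for j ∈ E_i ∪ {i}) such that: (a) Σ_{j ∈ E_i ∪ {i}} γ_{ij} ≤ 1 − ε for every i ∈ N; (b) α₁(‖x‖₂) ≤ V_i(x) ≤ α₂(‖x‖₂) for every i ∈ N and every x ∈ ℝ^{n_i}; (c) for every k ≥ 0 and every i ∈ N, if max_{j ∈ E_i ∪ {i}} max_{s ∈ {1,…,τ}} V_j(x_j(k+1−s)) ≤ p · V_i(x_i(k+1)), then V_i(x_i(k+1)) ≤ Σ_{j ∈ E_i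 ∪ {i}} γ_{ij} V_j(x_j(k)) + ψ · d_i(k). Then, setting ρ := max{p^{−1/(τ+1)}, 1−ε} ∈ (0,1), for every k ≥ 0 one has max_{i∈N} ‖x_i(k)‖₂ ≤ α₁^{−1}( p · ρ^k · α₂( max_{i∈N} max_{s∈{0,…,τ}} ‖x_i(−s)‖₂ ) + (ψ/ε) · D̄ ). -/
/-- A function `α : [0,∞) → [0,∞)` of class `K∞`: continuous, strictly
increasing, `α 0 = 0`, and `α r → ∞` as `r → ∞` (stated for `α : ℝ → ℝ`,
with the properties imposed on `[0,∞)`). -/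
def IsClassKInf (α : ℝ → ℝ) : Prop :=
  ContinuousOn α (Set.Ici 0) ∧ StrictMonoOn α (Set.Ici 0) ∧ α 0 = 0 ∧
    Filter.Tendsto α Filter.atTop Filter.atTop

/-- If `α` is strictly increasing on `[0,∞)` and `β` is a right inverse of `α` there, then
`α r ≤ y` gives `r ≤ β y`. -/
theorem StrictMonoOn.le_rightInverse_of_le {α β : ℝ → ℝ} (hα : StrictMonoOn α (Set.Ici 0))
    (hαβ : ∀ y, 0 ≤ y → α (β y) = y) (hβ : ∀ y, 0 ≤ y → 0 ≤ β y) {r y : ℝ} (hr : 0 ≤ r)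
    (hy : 0 ≤ y) (h : α r ≤ y) : r ≤ β y := by
  rw [← hαβ y hy] at h
  exact (hα.le_iff_le hr (hβ y hy)).1 h

/-- A vector Razumikhin comparison principle in discrete time.  If each successor value
`W i (k + 1)` is either smaller than `1 / p` times some value in the preceding window of length
`τ`, or at most `1 - ε` times any upper bound for the current values plus `ε * c`, then `W` decays
geometrically up to the offset `c`. -/
theorem razumikhin_geometric_bound {ι : Type*} {W : ι → ℤ → ℝ} {τ : ℕ} {p ε ρ M c : ℝ}
    (hp : 1 < p) (hρ0 : 0 < ρ) (hρ1 : ρ < 1) (hρε : 1 - ε ≤ ρ)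
    (hρp : 1 ≤ p * ρ ^ τ) (hM : 0 ≤ M) (hc : 0 ≤ c)
    (hinit : ∀ i, ∀ t : ℤ, -(τ : ℤ) ≤ t → t ≤ 0 → W i t ≤ M)
    (hstep : ∀ (k : ℕ) (i : ι),
      (∃ j, ∃ s : ℕ, 1 ≤ s ∧ s ≤ τ ∧ p * W i (k + 1) < W j (k + 1 - s)) ∨
      ∀ B, (∀ j, W j k ≤ B) → W i (k + 1) ≤ (1 - ε) * B + ε * c) (k : ℕ) (i : ι) :
    W i k ≤ p * ρ ^ k * M + c := by
  suffices H : ∀ m : ℕ, ∀ i, ∀ t : ℤ, -(τ : ℤ) ≤ t → t ≤ m → W i t ≤ p * ρ ^ t * M + c by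
    simpa using H k i k (by lia) le_rfl
  intro m
  induction m with
  | zero =>
    intro i t ht ht0
    have hρt : 1 ≤ ρ ^ t := one_le_zpow_of_nonpos₀ hρ0 hρ1.le (by simpa using ht0)
    have hpρ : 1 ≤ p * ρ ^ t := one_le_mul_of_one_le_of_one_le hp.le hρt
    nlinarith [hinit i t ht (by simpa using ht0), le_mul_of_one_le_left hM hpρ]
  | succ m ih =>
    intro i t ht htm
    rcases lt_or_ge (m : ℤ) t with hlt | hle
    swap
    · exact ih i t ht hle
    obtain rfl : t = m + 1 := by push_cast at htm; lia
    rcases hstep m i with ⟨j, s, hs1, hsτ, hlt⟩ | hdecr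
    · have hW := ih j (m + 1 - s) (by lia) (by lia)
      have hρs : 1 ≤ p * ρ ^ s :=
        hρp.trans (mul_le_mul_of_nonneg_left (pow_le_pow_of_le_one hρ0.le hρ1.le hsτ) (by linarith))
      have hsplit : ρ ^ ((m : ℤ) + 1) = ρ ^ ((m : ℤ) + 1 - s) * ρ ^ s := by
        rw [← zpow_natCast, ← zpow_add₀ hρ0.ne', sub_add_cancel]
      have hA : ρ ^ ((m : ℤ) + 1 - s) ≤ p * ρ ^ ((m : ℤ) + 1) := by
        rw [hsplit]
        nlinarith [zpow_pos hρ0 ((m : ℤ) + 1 - s)]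
      have hpA : p * ρ ^ ((m : ℤ) + 1 - s) * M ≤ p * (p * ρ ^ ((m : ℤ) + 1)) * M := by gcongr
      have hcp : c ≤ p * c := le_mul_of_one_le_left hc hp.le
      refine le_of_mul_le_mul_left ?_ (show 0 < p by linarith)
      linarith
    · have hW := hdecr _ fun j => by simpa using ih j m (by lia) le_rfl
      have hpow : (1 - ε) * (p * ρ ^ m * M) ≤ ρ * (p * ρ ^ m * M) := by gcongr
      have hsucc : ρ ^ ((m : ℤ) + 1) = ρ ^ m * ρ := by
        rw [zpow_add_one₀ hρ0.ne', zpow_natCast]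
      rw [hsucc]
      linarith

/-- **Theorem 1 (discrete-time sISS via vector Lyapunov–Razumikhin functions)**
with the explicit comparison functions of Remark 1: under the small-gain
condition, the class-`K∞` bounds, and the Razumikhin conditional decrement
(evaluated at the successor state), the composite state maximum obeys the
explicit sISS estimate with `ρ = max{p^{−1/(τ+1)}, 1−ε} ∈ (0,1)`,
`β(r,k) = α₁⁻¹(p ρ^k α₂(r))` and `μ(r) = α₁⁻¹((ψ/ε) r)`.  The inverse of the
surjective class-`K∞` function `α₁` is carried explicitly as `α₁inv`. -/
theorem discrete_sISS_vector_lyapunov_razumikhin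
    {ι : Type*} [Fintype ι] [Nonempty ι] [DecidableEq ι]
    (τ : ℕ) (hτ : 1 ≤ τ)
    (E : ι → Finset ι)
    (n : ι → ℕ) (hn : ∀ i, 1 ≤ n i)
    (x : (i : ι) → ℤ → EuclideanSpace ℝ (Fin (n i)))
    (d : ι → ℕ → ℝ) (hd : ∀ i k, 0 ≤ d i k)
    (Dbar : ℝ)
    (hDbar : IsLUB (Set.range fun k : ℕ =>
      Finset.univ.sup' Finset.univ_nonempty fun i => d i k) Dbar)
    (p ε ψ : ℝ) (hp : 1 < p) (hε : ε ∈ Set.Ioo (0:ℝ) 1) (hψ : 0 ≤ ψ)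
    (α₁ α₂ : ℝ → ℝ) (hα₁ : IsClassKInf α₁) (hα₂ : IsClassKInf α₂)
    (α₁inv : ℝ → ℝ)
    (hinv₁ : ∀ y, 0 ≤ y → α₁ (α₁inv y) = y)
    (hinv₂ : ∀ r, 0 ≤ r → α₁inv (α₁ r) = r)
    (hinv₃ : ∀ y, 0 ≤ y → 0 ≤ α₁inv y)
    (V : (i : ι) → EuclideanSpace ℝ (Fin (n i)) → ℝ)
    (hVnonneg : ∀ i x', 0 ≤ V i x')
    (γ : ι → ι → ℝ)
    (hγ : ∀ i j, j ∈ insert i (E i) → 0 ≤ γ i j)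
    (hsg : ∀ i, ∑ j ∈ insert i (E i), γ i j ≤ 1 - ε)
    (hbounds : ∀ i x', α₁ ‖x'‖ ≤ V i x' ∧ V i x' ≤ α₂ ‖x'‖)
    (hdec : ∀ (k : ℕ) (i : ι),
      ((insert i (E i)).sup' (Finset.insert_nonempty i (E i)) fun j =>
          (Finset.Icc 1 τ).sup' (Finset.nonempty_Icc.mpr hτ) fun s =>
            V j (x j ((k : ℤ) + 1 - (s : ℤ)))) ≤ p * V i (x i ((k : ℤ) + 1)) →
      V i (x i ((k : ℤ) + 1)) ≤
        (∑ j ∈ insert i (E i), γ i j * V j (x j (k : ℤ))) + ψ * d i k) :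
    max (p ^ (-(1 : ℝ) / ((τ : ℝ) + 1))) (1 - ε) ∈ Set.Ioo (0:ℝ) 1 ∧
    ∀ k : ℕ,
      (Finset.univ.sup' Finset.univ_nonempty fun i => ‖x i (k : ℤ)‖) ≤
        α₁inv (p * (max (p ^ (-(1 : ℝ) / ((τ : ℝ) + 1))) (1 - ε)) ^ k *
            α₂ (Finset.univ.sup' Finset.univ_nonempty fun i =>
              (Finset.Icc 0 τ).sup' (Finset.nonempty_Icc.mpr (Nat.zero_le τ)) fun s =>
                ‖x i (-(s : ℤ))‖) +
          ψ / ε * Dbar) := by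
  obtain ⟨hε0, hε1⟩ := hε
  set ρ := max (p ^ (-(1 : ℝ) / ((τ : ℝ) + 1))) (1 - ε)
  have hp0 : 0 < p := by linarith
  have hρ0 : 0 < ρ := lt_max_of_lt_right (by linarith)
  have hρ1 : ρ < 1 :=
    max_lt (Real.rpow_lt_one_of_one_lt_of_neg hp
      (div_neg_of_neg_of_pos (by norm_num) (by positivity))) (by linarith)
  refine ⟨⟨hρ0, hρ1⟩, fun k => ?_⟩
  have hρp : 1 ≤ p * ρ ^ τ := by
    have hroot : (p ^ (-(1 : ℝ) / ((τ : ℝ) + 1))) ^ (τ + 1) = p⁻¹ := by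
      rw [← Real.rpow_natCast, ← Real.rpow_mul hp0.le, ← Real.rpow_neg_one]
      congr 1
      push_cast
      field_simp
    have hle : p⁻¹ ≤ ρ ^ τ := calc
      p⁻¹ = (p ^ (-(1 : ℝ) / ((τ : ℝ) + 1))) ^ (τ + 1) := hroot.symm
      _ ≤ ρ ^ (τ + 1) := pow_le_pow_left₀ (by positivity) (le_max_left _ _) _
      _ ≤ ρ ^ τ := pow_le_pow_of_le_one hρ0.le hρ1.le (Nat.le_succ τ)
    calc 1 = p * p⁻¹ := (mul_inv_cancel₀ hp0.ne').symm
      _ ≤ p * ρ ^ τ := by gcongr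
  have hdD : ∀ i k, d i k ≤ Dbar := fun i k =>
    (Finset.le_sup' (fun i => d i k) (Finset.mem_univ i)).trans (hDbar.1 ⟨k, rfl⟩)
  have hD : 0 ≤ Dbar := (hd (Classical.arbitrary ι) 0).trans (hdD _ 0)
  have hc : 0 ≤ ψ / ε * Dbar := by positivity
  set R := Finset.univ.sup' Finset.univ_nonempty fun i =>
    (Finset.Icc 0 τ).sup' (Finset.nonempty_Icc.mpr (Nat.zero_le τ)) fun s => ‖x i (-(s : ℤ))‖
  have hR : ∀ i, ∀ s ∈ Finset.Icc 0 τ, ‖x i (-(s : ℤ))‖ ≤ R := fun i s hs =>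
    (Finset.le_sup' (fun s : ℕ => ‖x i (-(s : ℤ))‖) hs).trans
      (Finset.le_sup' (fun i => (Finset.Icc 0 τ).sup' (Finset.nonempty_Icc.mpr (Nat.zero_le τ))
        fun s : ℕ => ‖x i (-(s : ℤ))‖) (Finset.mem_univ i))
  have hinit : ∀ i, ∀ t : ℤ, -(τ : ℤ) ≤ t → t ≤ 0 → V i (x i t) ≤ α₂ R := by
    intro i t ht ht0
    obtain ⟨s, rfl⟩ : ∃ s : ℕ, t = -(s : ℤ) := ⟨t.natAbs, by lia⟩
    have hs := hR i s (Finset.mem_Icc.2 ⟨s.zero_le, by lia⟩)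
    exact (hbounds i _).2.trans
      (hα₂.2.1.monotoneOn (norm_nonneg _) ((norm_nonneg _).trans hs) hs)
  have hM : 0 ≤ α₂ R :=
    (hVnonneg _ _).trans (hinit (Classical.arbitrary ι) 0 (by lia) le_rfl)
  have hstep : ∀ (k : ℕ) (i : ι),
      (∃ j, ∃ s : ℕ, 1 ≤ s ∧ s ≤ τ ∧
        p * V i (x i ((k : ℤ) + 1)) < V j (x j ((k : ℤ) + 1 - s))) ∨
      ∀ B, (∀ j, V j (x j k) ≤ B) →
        V i (x i ((k : ℤ) + 1)) ≤ (1 - ε) * B + ε * (ψ / ε * Dbar) := by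
    intro k i
    by_cases h : ((insert i (E i)).sup' (Finset.insert_nonempty i (E i)) fun j =>
        (Finset.Icc 1 τ).sup' (Finset.nonempty_Icc.mpr hτ) fun s =>
          V j (x j ((k : ℤ) + 1 - (s : ℤ)))) ≤ p * V i (x i ((k : ℤ) + 1))
    · right
      intro B hB
      have hB0 : 0 ≤ B := (hVnonneg i _).trans (hB i)
      have hsum : ∑ j ∈ insert i (E i), γ i j * V j (x j (k : ℤ)) ≤ (1 - ε) * B := calc
        _ ≤ ∑ j ∈ insert i (E i), γ i j * B :=
          Finset.sum_le_sum fun j hj => mul_le_mul_of_nonneg_left (hB j) (hγ i j hj)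
        _ = (∑ j ∈ insert i (E i), γ i j) * B := (Finset.sum_mul _ _ _).symm
        _ ≤ (1 - ε) * B := mul_le_mul_of_nonneg_right (hsg i) hB0
      have hψD : ψ * d i k ≤ ψ * Dbar := mul_le_mul_of_nonneg_left (hdD i k) hψ
      have hεc : ε * (ψ / ε * Dbar) = ψ * Dbar := by field_simp
      linarith [hdec k i h]
    · left
      obtain ⟨j, -, hj⟩ := (Finset.lt_sup'_iff _).1 (not_le.1 h)
      obtain ⟨s, hs, hlt⟩ := (Finset.lt_sup'_iff _).1 hj
      exact ⟨j, s, (Finset.mem_Icc.1 hs).1, (Finset.mem_Icc.1 hs).2, hlt⟩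
  refine Finset.sup'_le _ _ fun i _ => ?_
  exact hα₁.2.1.le_rightInverse_of_le hinv₁ hinv₃ (norm_nonneg _) (by positivity)
    ((hbounds i _).1.trans (razumikhin_geometric_bound (W := fun i t => V i (x i t))
      hp hρ0 hρ1 (le_max_right _ _) hρp hM hc hinit hstep k i))
end

section
/- Let N be a finite nonempty set, τ ≥ 1 an integer, p > 1, ε ∈ (0,1), ψ ≥ 0, and d̄ ≥ 0. For each i ∈ N let V_i : ℤ → [0,∞) (only values at times k ≥ −τ are used), set W(k) := max_{i∈N} V_i(k), and let δ : ℕ → [0,∞) satisfy δ(k) ≤ d̄ for all k. Set D := (ψ/ε)·d̄, M := max_{s∈{0,…,τ}} W(−s), ρ := max{p^{−1/(τ+1)}, 1−ε}, and assume R > D. Suppose: (i) for every k ≥ 0 with W(k+1) > R and every i ∈ N, either V_i(k+1) ≤ (1/p)·max_{s∈{1,…,τ}} W(k+1−s) or V_i(k+1) ≤ (1−ε)·W(k) + ψ·δ(k); and (ii) for every k ≥ 0 with W(k) ≤ R, W(k+1) ≤ (1−ε)·W(k) + ψ·δ(k). Then there exists K ≤ max{0, ⌈ln((R−D)/(p·M))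 / ln ρ⌉} (interpreting K = 0 when M = 0) such that W(k) ≤ R for all k ≥ K. -/
/-- If `ρ ∈ (0, 1)` and `log y / log ρ ≤ n`, then `ρ ^ n ≤ y`. -/
theorem pow_le_of_log_div_log_le {ρ y : ℝ} {n : ℕ} (hρ0 : 0 < ρ) (hρ1 : ρ < 1) (hy : 0 < y)
    (h : Real.log y / Real.log ρ ≤ n) : ρ ^ n ≤ y := by
  rw [← Real.log_le_log_iff (pow_pos hρ0 n) hy, Real.log_pow]
  exact (div_le_iff_of_neg (Real.log_neg hρ0 hρ1)).1 h

/-- The root `p ^ (-1 / (τ + 1))` lies below `ρ`, so `p⁻¹ ≤ ρ ^ (τ + 1)`. -/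
theorem inv_le_pow_of_rpow_le {p ρ : ℝ} {τ : ℕ} (hp : 0 < p)
    (h : p ^ (-(1 : ℝ) / ((τ : ℝ) + 1)) ≤ ρ) : p⁻¹ ≤ ρ ^ (τ + 1) := by
  calc p⁻¹ = (p ^ (-(1 : ℝ) / ((τ : ℝ) + 1))) ^ (τ + 1) := by
        have hτ : (τ : ℝ) + 1 ≠ 0 := by positivity
        rw [← Real.rpow_natCast, ← Real.rpow_mul hp.le]
        push_cast
        rw [div_mul_cancel₀ _ hτ, Real.rpow_neg_one]
    _ ≤ ρ ^ (τ + 1) := pow_le_pow_left₀ (Real.rpow_nonneg hp.le _) h _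

/-- A delayed Razumikhin-type comparison: while the sequence `W` has not entered `{W ≤ R}`, it
stays below the geometric envelope `D + M * ρ ^ j`. -/
theorem le_or_forall_le_geometric {W : ℤ → ℝ} {τ : ℕ} {p ε D M ρ R : ℝ}
    (hp : 1 < p) (hε : ε ≤ 1) (hD : 0 ≤ D) (hM : 0 ≤ M) (hρ0 : 0 < ρ) (hρ1 : ρ < 1)
    (hρp : p⁻¹ ≤ ρ ^ (τ + 1)) (hρε : 1 - ε ≤ ρ)
    (hinit : ∀ j : ℤ, -(τ : ℤ) ≤ j → j ≤ 0 → W j ≤ M)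
    (hinv : ∀ k : ℕ, W k ≤ R → W ((k : ℤ) + 1) ≤ R)
    (hout : ∀ k : ℕ, R < W ((k : ℤ) + 1) →
      (∃ s ∈ Finset.Icc 1 τ, W ((k : ℤ) + 1) ≤ p⁻¹ * W ((k : ℤ) + 1 - (s : ℤ))) ∨
        W ((k : ℤ) + 1) ≤ (1 - ε) * W k + ε * D) (k : ℕ) :
    W k ≤ R ∨ ∀ j : ℤ, -(τ : ℤ) ≤ j → j ≤ k → W j ≤ D + M * ρ ^ j := by
  induction k with
  | zero =>
    refine Or.inr fun j hj hj0 => ?_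
    have h1 : 1 ≤ ρ ^ j := one_le_zpow_of_nonpos₀ hρ0 hρ1.le (by simpa using hj0)
    nlinarith [hinit j hj (by simpa using hj0)]
  | succ k ih =>
    push_cast
    rcases le_or_gt (W ((k : ℤ) + 1)) R with hR | hR
    · exact Or.inl hR
    have hb := ih.resolve_left fun h => hR.not_ge (hinv k h)
    refine Or.inr fun j hj hjk => ?_
    rcases hjk.lt_or_eq with hlt | rfl
    · exact hb j hj (by omega)
    rcases hout k hR with ⟨s, hs, h⟩ | h
    · rw [Finset.mem_Icc] at hs
      have hp0 : 0 < p⁻¹ := by positivity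
      have hp1 : p⁻¹ ≤ 1 := inv_le_one_of_one_le₀ hp.le
      have hW := hb ((k : ℤ) + 1 - s) (by omega) (by omega)
      have hpow : p⁻¹ * ρ ^ ((k : ℤ) + 1 - s) ≤ ρ ^ ((k : ℤ) + 1) := by
        have hs' : p⁻¹ ≤ ρ ^ s :=
          hρp.trans (pow_le_pow_of_le_one hρ0.le hρ1.le (by omega))
        calc p⁻¹ * ρ ^ ((k : ℤ) + 1 - s) ≤ ρ ^ s * ρ ^ ((k : ℤ) + 1 - s) := by gcongr
          _ = ρ ^ ((k : ℤ) + 1) := by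
            rw [← zpow_natCast, ← zpow_add₀ hρ0.ne']
            congr 1
            ring
      calc W ((k : ℤ) + 1) ≤ p⁻¹ * (D + M * ρ ^ ((k : ℤ) + 1 - s)) :=
            h.trans (mul_le_mul_of_nonneg_left hW hp0.le)
        _ = p⁻¹ * D + M * (p⁻¹ * ρ ^ ((k : ℤ) + 1 - s)) := by ring
        _ ≤ D + M * ρ ^ ((k : ℤ) + 1) :=
            add_le_add (mul_le_of_le_one_left hD hp1) (mul_le_mul_of_nonneg_left hpow hM)
    · have hW := hb k (by omega) le_rfl
      calc W ((k : ℤ) + 1) ≤ (1 - ε) * (D + M * ρ ^ (k : ℤ)) + ε * D :=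
            h.trans (by gcongr)
        _ = D + (1 - ε) * (M * ρ ^ (k : ℤ)) := by ring
        _ ≤ D + ρ * (M * ρ ^ (k : ℤ)) := by gcongr
        _ = D + M * ρ ^ ((k : ℤ) + 1) := by rw [zpow_add_one₀ hρ0.ne']; ring


/-- **Two-stage verification** (Theorem 2 of the paper): outside the sublevel
set `{W ≤ R}` the Razumikhin-type disjunction holds for each agent, inside it
an unconditional geometric decrement holds; the conclusion is finite-time
entry into `{W ≤ R}` (by the explicit time bound
`max{0, ⌈ln((R−D)/(p·M)) / ln ρ⌉}`, interpreted as `0` when `M = 0`) together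
with forward invariance. -/
theorem two_stage_verification
    {ι : Type*} [Fintype ι] [Nonempty ι]
    (τ : ℕ) (hτ : 1 ≤ τ)
    (p ε ψ dbar : ℝ) (hp : 1 < p) (hε : ε ∈ Set.Ioo (0:ℝ) 1) (hψ : 0 ≤ ψ)
    (hdbar : 0 ≤ dbar)
    (V : ι → ℤ → ℝ) (hV : ∀ i k, 0 ≤ V i k)
    (W : ℤ → ℝ)
    (hW : ∀ k : ℤ, W k = Finset.univ.sup' Finset.univ_nonempty fun i => V i k)
    (δ : ℕ → ℝ) (hδ0 : ∀ k, 0 ≤ δ k) (hδ : ∀ k, δ k ≤ dbar)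
    (D M ρ R : ℝ)
    (hD : D = ψ / ε * dbar)
    (hM : M = (Finset.Icc 0 τ).sup' (Finset.nonempty_Icc.mpr (Nat.zero_le τ))
      fun s => W (-(s : ℤ)))
    (hρ : ρ = max (p ^ (-(1 : ℝ) / ((τ : ℝ) + 1))) (1 - ε))
    (hR : D < R)
    (hout : ∀ (k : ℕ) (i : ι), R < W ((k : ℤ) + 1) →
      V i ((k : ℤ) + 1) ≤ (1 / p) *
          (Finset.Icc 1 τ).sup' (Finset.nonempty_Icc.mpr hτ)
            (fun s => W ((k : ℤ) + 1 - (s : ℤ))) ∨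
      V i ((k : ℤ) + 1) ≤ (1 - ε) * W (k : ℤ) + ψ * δ k)
    (hin : ∀ k : ℕ, W (k : ℤ) ≤ R →
      W ((k : ℤ) + 1) ≤ (1 - ε) * W (k : ℤ) + ψ * δ k) :
    ∃ K : ℕ,
      (K : ℤ) ≤ (if M = 0 then 0
        else max 0 ⌈Real.log ((R - D) / (p * M)) / Real.log ρ⌉) ∧
      ∀ k : ℕ, K ≤ k → W (k : ℤ) ≤ R := by
  obtain ⟨hε0, hε1⟩ := hε
  have hp0 : 0 < p := by linarith
  have hD0 : 0 ≤ D := by rw [hD]; positivity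
  have hψδ (k : ℕ) : ψ * δ k ≤ ε * D := by
    have : ε * D = ψ * dbar := by rw [hD]; field_simp
    rw [this]
    exact mul_le_mul_of_nonneg_left (hδ k) hψ
  have hinv (k : ℕ) (h : W k ≤ R) : W ((k : ℤ) + 1) ≤ R := by
    nlinarith [hin k h, hψδ k]
  have hinit (j : ℤ) (hj : -(τ : ℤ) ≤ j) (hj0 : j ≤ 0) : W j ≤ M := by
    obtain ⟨s, rfl⟩ : ∃ s : ℕ, j = -(s : ℤ) := ⟨j.natAbs, by omega⟩
    rw [hM]
    exact Finset.le_sup' (fun s : ℕ => W (-(s : ℤ))) (by simp; omega)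
  have hW0 (k : ℤ) : 0 ≤ W k := by
    rw [hW]
    exact (hV (Classical.arbitrary ι) k).trans
      (Finset.le_sup' (fun i => V i k) (Finset.mem_univ _))
  have hM0 : 0 ≤ M := (hW0 0).trans (hinit 0 (by omega) le_rfl)
  have hρ0 : 0 < ρ := by
    rw [hρ]
    exact lt_max_of_lt_right (by linarith)
  have hρ1 : ρ < 1 := by
    rw [hρ]
    refine max_lt (Real.rpow_lt_one_of_one_lt_of_neg hp ?_) (by linarith)
    exact div_neg_of_neg_of_pos (by norm_num) (by positivity)
  have hρp : p⁻¹ ≤ ρ ^ (τ + 1) := inv_le_pow_of_rpow_le hp0 (hρ ▸ le_max_left _ _)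
  have hρε : 1 - ε ≤ ρ := hρ ▸ le_max_right _ _
  have hout' (k : ℕ) (h : R < W ((k : ℤ) + 1)) :
      (∃ s ∈ Finset.Icc 1 τ, W ((k : ℤ) + 1) ≤ p⁻¹ * W ((k : ℤ) + 1 - (s : ℤ))) ∨
        W ((k : ℤ) + 1) ≤ (1 - ε) * W k + ε * D := by
    obtain ⟨i, -, hi⟩ := Finset.exists_mem_eq_sup' (Finset.univ_nonempty (α := ι))
      fun i => V i ((k : ℤ) + 1)
    rw [← hW] at hi
    obtain ⟨s, hs, hs'⟩ := Finset.exists_mem_eq_sup' (Finset.nonempty_Icc.mpr hτ)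
      fun s : ℕ => W ((k : ℤ) + 1 - (s : ℤ))
    rcases hout k i h with h | h
    · rw [hs', one_div, ← hi] at h
      exact Or.inl ⟨s, hs, h⟩
    · exact Or.inr (by linarith [hψδ k])
  have hstay (K : ℕ) (hK : W K ≤ R) (k : ℕ) (hk : K ≤ k) : W k ≤ R := by
    induction k, hk using Nat.le_induction with
    | base => exact hK
    | succ k _ ih => exact_mod_cast hinv k ih
  by_cases hMz : M = 0
  · refine ⟨0, by simp [hMz], hstay 0 ?_⟩
    have := hinit 0 (by omega) le_rfl
    simp only [Nat.cast_zero]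
    linarith
  · have hMpos : 0 < M := lt_of_le_of_ne hM0 (Ne.symm hMz)
    set x := Real.log ((R - D) / (p * M)) / Real.log ρ with hx
    refine ⟨⌈x⌉.toNat, by rw [if_neg hMz]; omega, hstay _ ?_⟩
    have hxK : x ≤ (⌈x⌉.toNat : ℝ) :=
      (Int.le_ceil x).trans (by exact_mod_cast Int.self_le_toNat ⌈x⌉)
    generalize ⌈x⌉.toNat = K at hxK ⊢
    have hpow : ρ ^ K ≤ (R - D) / (p * M) :=
      pow_le_of_log_div_log_le hρ0 hρ1 (div_pos (by linarith) (by positivity)) hxK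
    rcases le_or_forall_le_geometric hp hε1.le hD0 hM0 hρ0 hρ1 hρp hρε hinit hinv hout' K
      with h | h
    · exact h
    have hK := h K (by omega) le_rfl
    rw [zpow_natCast] at hK
    rw [le_div_iff₀ (by positivity)] at hpow
    have hMK : 0 ≤ M * ρ ^ K := by positivity
    nlinarith
end

section
/- Let p > 1 and let τ ≥ 1 be an integer. Let W : ℤ → [0,∞) satisfy W(k) ≤ (1/p) · max_{s ∈ {1,…,τ}} W(k−s) for every k ≥ 1. Then, with M := max_{s ∈ {0,…,τ}} W(−s), for every k ≥ 0 one has W(k) ≤ p^{−⌊k/(τ+1)⌋} · M, and consequently W(k) ≤ p · exp(−(ln p)·k/(τ+1)) · M. -/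
/-- A bound by the maximum over the initial window `-τ, …, 0`, together with contraction by `1/p`
relative to some value among the previous `τ` ones, gives geometric decay along blocks of
length `τ + 1`. -/
theorem le_inv_pow_div_mul_of_delayed_contraction {p M : ℝ} (hp : 1 ≤ p) {τ : ℕ} {W : ℤ → ℝ}
    (hM0 : 0 ≤ M) (hinit : ∀ s : ℕ, s ≤ τ → W (-(s : ℤ)) ≤ M)
    (hdec : ∀ k : ℕ, 1 ≤ k → ∃ s : ℕ, 1 ≤ s ∧ s ≤ τ ∧ W k ≤ p⁻¹ * W ((k : ℤ) - s)) (k : ℕ) :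
    W k ≤ (p ^ (k / (τ + 1)))⁻¹ * M := by
  have hp0 : 0 < p := by linarith
  induction k using Nat.strong_induction_on with
  | _ k ih =>
    rcases Nat.eq_zero_or_pos k with rfl | hk
    · simpa using hinit 0 (Nat.zero_le τ)
    obtain ⟨s, hs1, hsτ, hle⟩ := hdec k hk
    rcases le_or_gt s k with hsk | hks
    · have hdiv : k / (τ + 1) ≤ (k - s) / (τ + 1) + 1 := by
        rw [← Nat.add_div_right _ (Nat.succ_pos τ)]
        exact Nat.div_le_div_right (by omega)
      have hW := ih (k - s) (by omega)
      rw [Nat.cast_sub hsk] at hW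
      calc W k ≤ p⁻¹ * W ((k : ℤ) - s) := hle
        _ ≤ p⁻¹ * ((p ^ ((k - s) / (τ + 1)))⁻¹ * M) := by gcongr
        _ = (p ^ ((k - s) / (τ + 1) + 1))⁻¹ * M := by rw [pow_succ, mul_inv]; ring
        _ ≤ (p ^ (k / (τ + 1)))⁻¹ * M := by gcongr
    · have hW := hinit (s - k) (by omega)
      rw [Nat.cast_sub hks.le, neg_sub] at hW
      rw [Nat.div_eq_of_lt (by omega), pow_zero, inv_one, one_mul]
      calc W k ≤ p⁻¹ * W ((k : ℤ) - s) := hle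
        _ ≤ p⁻¹ * M := by gcongr
        _ ≤ M := mul_le_of_le_one_left hM0 (inv_le_one_of_one_le₀ hp)

/-- Geometric decay along blocks of length `n` is dominated by exponential decay with rate
`log p / n`, up to a factor `p`. -/
theorem inv_pow_div_le_mul_exp {p : ℝ} (hp : 1 ≤ p) {n : ℕ} (hn : 0 < n) (k : ℕ) :
    (p ^ (k / n))⁻¹ ≤ p * Real.exp (-(Real.log p) * k / n) := by
  have hp0 : 0 < p := by linarith
  have hlt : (k : ℝ) / n ≤ (k / n : ℕ) + 1 := by
    rw [div_le_iff₀ (by exact_mod_cast hn), mul_comm]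
    exact_mod_cast (Nat.lt_mul_div_succ k hn).le
  have hexp : (p ^ (k / n))⁻¹ = Real.exp (-((k / n : ℕ) * Real.log p)) := by
    rw [Real.exp_neg, Real.exp_nat_mul, Real.exp_log hp0]
  rw [hexp]
  calc Real.exp (-((k / n : ℕ) * Real.log p))
      ≤ Real.exp (Real.log p + -(Real.log p) * k / n) := by
        rw [Real.exp_le_exp, mul_div_assoc]
        nlinarith [mul_le_mul_of_nonneg_left hlt (Real.log_nonneg hp)]
    _ = p * Real.exp (-(Real.log p) * k / n) := by rw [Real.exp_add, Real.exp_log hp0]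

/-- **Case 1 decay estimate** (proof of Theorem 1): if the Razumikhin condition
fails at every step, the running maximum of the Lyapunov values contracts by a
factor `1/p` every `τ+1` steps, yielding exponential decay with rate
`exp(−(ln p)/(τ+1))`.  (For `k : ℕ`, `k / (τ+1)` is natural division, i.e.
`⌊k/(τ+1)⌋`.) -/
theorem razumikhin_failure_decay
    (p : ℝ) (hp : 1 < p) (τ : ℕ) (hτ : 1 ≤ τ)
    (W : ℤ → ℝ) (hW0 : ∀ k, 0 ≤ W k)
    (hdec : ∀ k : ℤ, 1 ≤ k →
      W k ≤ (1 / p) *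
        (Finset.Icc 1 τ).sup' (Finset.nonempty_Icc.mpr hτ) fun s => W (k - (s : ℤ)))
    (M : ℝ)
    (hM : M = (Finset.Icc 0 τ).sup' (Finset.nonempty_Icc.mpr (Nat.zero_le τ))
      fun s => W (-(s : ℤ))) :
    ∀ k : ℕ,
      W (k : ℤ) ≤ (p ^ (k / (τ + 1)))⁻¹ * M ∧
      W (k : ℤ) ≤ p * Real.exp (-(Real.log p) * (k : ℝ) / ((τ : ℝ) + 1)) * M := by
  intro k
  have hinit : ∀ s : ℕ, s ≤ τ → W (-(s : ℤ)) ≤ M := fun s hs => by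
    rw [hM]
    exact Finset.le_sup' (fun s : ℕ => W (-(s : ℤ))) (Finset.mem_Icc.mpr ⟨Nat.zero_le s, hs⟩)
  have hM0 : 0 ≤ M := (hW0 _).trans (hinit 0 (Nat.zero_le τ))
  have hfloor : W k ≤ (p ^ (k / (τ + 1)))⁻¹ * M := by
    refine le_inv_pow_div_mul_of_delayed_contraction hp.le hM0 hinit (fun j hj => ?_) k
    obtain ⟨s, hs, hsup⟩ := Finset.exists_mem_eq_sup' (Finset.nonempty_Icc.mpr hτ)
      fun s : ℕ => W ((j : ℤ) - s)
    have hle := hdec j (by exact_mod_cast hj)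
    rw [hsup, one_div] at hle
    exact ⟨s, (Finset.mem_Icc.mp hs).1, (Finset.mem_Icc.mp hs).2, hle⟩
  refine ⟨hfloor, hfloor.trans (mul_le_mul_of_nonneg_right ?_ hM0)⟩
  exact_mod_cast inv_pow_div_le_mul_exp hp.le (Nat.succ_pos τ) k
end

section
/- Let N be a finite nonempty set, τ ≥ 1 an integer, p > 1, ε ∈ (0,1), ψ ≥ 0, and D̄ ≥ 0. For each i ∈ N let V_i : ℤ → [0,∞) (only values at times k ≥ −τ are used), set W(k) := max_{i∈N} V_i(k), and let δ : ℕ → [0,∞) satisfy δ(k) ≤ D̄ for all k. Suppose that for every k ≥ 0 and every i ∈ N, either V_i(k+1) ≤ (1/p) · max_{s ∈ {1,…,τ}} W(k+1−s) or V_i(k+1) ≤ (1−ε)·W(k) + ψ·δ(k). Then, with ρ := max{p^{−1/(τ+1)}, 1−ε} ∈ (0,1) and M := max_{s ∈ {0,…,τ}} W(−s), for every k ≥ 0 one has W(k) ≤ p · ρ^k · M + (ψ/ε) · D̄. -/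
/-- **Switching comparison estimate** (proof of Theorem 1, Case 3): at every
step each agent's Lyapunov value satisfies either the Razumikhin-failure bound
against the delayed window maximum or the small-gain geometric decrement; the
composite maximum then decays at the worse of the two rates
`ρ = max{p^{−1/(τ+1)}, 1−ε}` up to the ultimate disturbance level `(ψ/ε)·D̄`. -/
theorem switching_comparison
    {ι : Type*} [Fintype ι] [Nonempty ι]
    (τ : ℕ) (hτ : 1 ≤ τ)
    (p ε ψ Dbar : ℝ) (hp : 1 < p) (hε : ε ∈ Set.Ioo (0:ℝ) 1) (hψ : 0 ≤ ψ)
    (hDbar : 0 ≤ Dbar)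
    (V : ι → ℤ → ℝ) (hV : ∀ i k, 0 ≤ V i k)
    (W : ℤ → ℝ)
    (hW : ∀ k : ℤ, W k = Finset.univ.sup' Finset.univ_nonempty fun i => V i k)
    (δ : ℕ → ℝ) (hδ0 : ∀ k, 0 ≤ δ k) (hδ : ∀ k, δ k ≤ Dbar)
    (hstep : ∀ (k : ℕ) (i : ι),
      V i ((k : ℤ) + 1) ≤ (1 / p) *
          (Finset.Icc 1 τ).sup' (Finset.nonempty_Icc.mpr hτ)
            (fun s => W ((k : ℤ) + 1 - (s : ℤ))) ∨
      V i ((k : ℤ) + 1) ≤ (1 - ε) * W (k : ℤ) + ψ * δ k)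
    (ρ M : ℝ)
    (hρ : ρ = max (p ^ (-(1 : ℝ) / ((τ : ℝ) + 1))) (1 - ε))
    (hM : M = (Finset.Icc 0 τ).sup' (Finset.nonempty_Icc.mpr (Nat.zero_le τ))
      fun s => W (-(s : ℤ))) :
    ρ ∈ Set.Ioo (0:ℝ) 1 ∧ ∀ k : ℕ, W (k : ℤ) ≤ p * ρ ^ k * M + ψ / ε * Dbar := by
  obtain ⟨hε0, hε1⟩ := hε
  have hp0 : 0 < p := by linarith
  have hτ0 : (0 : ℝ) < (τ : ℝ) + 1 := by positivity
  have hbase0 : 0 < p ^ (-(1 : ℝ) / ((τ : ℝ) + 1)) := Real.rpow_pos_of_pos hp0 _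
  have hbase1 : p ^ (-(1 : ℝ) / ((τ : ℝ) + 1)) < 1 :=
    Real.rpow_lt_one_of_one_lt_of_neg hp (div_neg_of_neg_of_pos (by norm_num) hτ0)
  have hbase_pow : (p ^ (-(1 : ℝ) / ((τ : ℝ) + 1))) ^ (τ + 1) = 1 / p := by
    rw [← Real.rpow_natCast, ← Real.rpow_mul hp0.le]
    push_cast
    rw [div_mul_cancel₀ _ hτ0.ne', Real.rpow_neg_one, one_div]
  have hρ_base : p ^ (-(1 : ℝ) / ((τ : ℝ) + 1)) ≤ ρ := hρ ▸ le_max_left _ _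
  have hρ_eps : 1 - ε ≤ ρ := hρ ▸ le_max_right _ _
  have hρ0 : 0 < ρ := hbase0.trans_le hρ_base
  have hρ1 : ρ < 1 := hρ ▸ max_lt hbase1 (by linarith)
  have hp_inv : 1 / p ≤ ρ ^ τ := calc
    1 / p ≤ ρ ^ (τ + 1) := hbase_pow ▸ pow_le_pow_left₀ hbase0.le hρ_base _
    _ ≤ ρ ^ τ := pow_le_pow_of_le_one hρ0.le hρ1.le (Nat.le_succ τ)
  have hp_inv1 : 1 / p ≤ 1 := (div_le_one hp0).2 hp.le
  have hp_inv0 : 0 ≤ 1 / p := by positivity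
  have hW0 : ∀ k, 0 ≤ W k := fun k => by
    obtain ⟨i⟩ := ‹Nonempty ι›
    rw [hW]
    exact (hV i k).trans (Finset.le_sup' (fun i => V i k) (Finset.mem_univ i))
  have hWM : ∀ s : ℕ, s ≤ τ → W (-(s : ℤ)) ≤ M := fun s hs => by
    rw [hM]
    exact Finset.le_sup' (fun s : ℕ => W (-(s : ℤ))) (Finset.mem_Icc.2 ⟨Nat.zero_le s, hs⟩)
  have hM0 : 0 ≤ M := (hW0 _).trans (hWM 0 (Nat.zero_le τ))
  have hC0 : 0 ≤ ψ / ε * Dbar := by positivity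
  have hεC : ε * (ψ / ε * Dbar) = ψ * Dbar := by field_simp
  have hinv : ∀ n : ℕ, ∀ j : ℤ, -(τ : ℤ) ≤ j → j ≤ n →
      W j ≤ ρ ^ j * M + ψ / ε * Dbar := by
    intro n
    induction n with
    | zero =>
      intro j hj hj0
      obtain ⟨s, rfl⟩ : ∃ s : ℕ, j = -(s : ℤ) := ⟨j.natAbs, by omega⟩
      have h1 : 1 ≤ ρ ^ (-(s : ℤ)) := by
        rw [zpow_neg, zpow_natCast]
        exact (one_le_inv₀ (by positivity)).2 (pow_le_one₀ hρ0.le hρ1.le)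
      have h2 := hWM s (by omega)
      have h3 := le_mul_of_one_le_left hM0 h1
      linarith
    | succ n ih =>
      intro j hj hjn
      rcases hjn.lt_or_eq with hlt | rfl
      · exact ih j hj (by push_cast at hlt; omega)
      push_cast
      rw [hW]
      refine Finset.sup'_le _ _ fun i _ => ?_
      rcases hstep n i with h | h
      · refine h.trans ?_
        have hsup : (Finset.Icc 1 τ).sup' (Finset.nonempty_Icc.mpr hτ)
            (fun s : ℕ => W ((n : ℤ) + 1 - (s : ℤ))) ≤
            ρ ^ ((n : ℤ) + 1 - τ) * M + ψ / ε * Dbar := by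
          refine Finset.sup'_le _ _ fun s hs => ?_
          obtain ⟨hs1, hs2⟩ := Finset.mem_Icc.1 hs
          refine (ih _ (by omega) (by omega)).trans ?_
          have := zpow_le_zpow_right_of_le_one₀ hρ0 hρ1.le
            (show (n : ℤ) + 1 - τ ≤ (n : ℤ) + 1 - s by omega)
          gcongr
        have hpow : ρ ^ τ * ρ ^ ((n : ℤ) + 1 - τ) = ρ ^ ((n : ℤ) + 1) := by
          rw [← zpow_natCast, ← zpow_add₀ hρ0.ne']
          congr 1
          ring
        have hX : 0 ≤ ρ ^ ((n : ℤ) + 1 - τ) * M := by positivity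
        have h1 := mul_le_mul_of_nonneg_left hsup hp_inv0
        have h2 := mul_le_mul_of_nonneg_right hp_inv hX
        have h3 := mul_le_mul_of_nonneg_right hp_inv1 hC0
        rw [← mul_assoc (ρ ^ τ), hpow] at h2
        linarith
      · have h1 := mul_le_mul_of_nonneg_left (ih n (by omega) le_rfl)
          (show 0 ≤ 1 - ε by linarith)
        have h2 := mul_le_mul_of_nonneg_left (hδ n) hψ
        have hX : 0 ≤ ρ ^ (n : ℤ) * M := by positivity
        have h3 := mul_le_mul_of_nonneg_right hρ_eps hX
        rw [zpow_add_one₀ hρ0.ne']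
        linarith
  refine ⟨⟨hρ0, hρ1⟩, fun k => ?_⟩
  have h := hinv k k (by omega) le_rfl
  rw [zpow_natCast] at h
  have hX : 0 ≤ ρ ^ k * M := by positivity
  have hpX := le_mul_of_one_le_left hX hp.le
  linarith
end

section
/- Let m ≥ 1, let Z ⊆ ℝ^m, let D ⊆ Z, and let ε̄ ≥ 0 be such that for every z ∈ Z there exists ẑ ∈ D with ‖z − ẑ‖₂ ≤ ε̄. Let h, r : ℝ^m → ℝ and L_h, L_r ≥ 0 satisfy |h(z) − h(z')| ≤ L_h‖z − z'‖₂ and |r(z) − r(z')| ≤ L_r‖z − z'‖₂ for all z, z' ∈ Z, and let δ ≥ L_r·ε̄. If for every ẑ ∈ D either h(ẑ) < −L_h·ε̄ or r(ẑ) ≤ −δ, then for every z ∈ Z with h(z) ≥ 0 one has r(z) ≤ 0. -/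
/-- **Stage-1 (outside region) lifting lemma** (proof of Theorem 3): a robustly
margined disjunction verified on a finite covering set `D` implies the
implication `h(z) ≥ 0 ⇒ r(z) ≤ 0` at every point of the continuous domain `Z`. -/
theorem stage1_outside_lifting
    (m : ℕ) (hm : 1 ≤ m)
    (Z D : Set (EuclideanSpace ℝ (Fin m))) (hDZ : D ⊆ Z)
    (εb : ℝ) (hcover : ∀ z ∈ Z, ∃ zhat ∈ D, ‖z - zhat‖ ≤ εb)
    (h r : EuclideanSpace ℝ (Fin m) → ℝ)
    (Lh Lr : ℝ) (hLh : 0 ≤ Lh) (hLr : 0 ≤ Lr)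
    (hhLip : ∀ z ∈ Z, ∀ z' ∈ Z, |h z - h z'| ≤ Lh * ‖z - z'‖)
    (hrLip : ∀ z ∈ Z, ∀ z' ∈ Z, |r z - r z'| ≤ Lr * ‖z - z'‖)
    (δ : ℝ) (hδ : Lr * εb ≤ δ)
    (hsamp : ∀ zhat ∈ D, h zhat < -(Lh * εb) ∨ r zhat ≤ -δ) :
    ∀ z ∈ Z, 0 ≤ h z → r z ≤ 0 := by
  intro z hz hhz
  obtain ⟨zhat, hzhat, hdist⟩ := hcover z hz
  have hh := (le_abs_self _).trans (hhLip z hz zhat (hDZ hzhat))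
  have hr := (le_abs_self _).trans (hrLip z hz zhat (hDZ hzhat))
  have hh_le := mul_le_mul_of_nonneg_left hdist hLh
  have hr_le := mul_le_mul_of_nonneg_left hdist hLr
  rcases hsamp zhat hzhat with hneg | hmargin <;> linarith
end
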